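/- S¹×S¹ cannot be covered by two symmetric open subsets each of which admits a symmetric motion planning rule. -/

import Mathlib

open unitInterval

/-- A subset of `S¹ × S¹` is symmetric if `(x, y) ∈ V` implies `(y, x) ∈ V`. -/
def IsSymmetricSet (V : Set (Circle × Circle)) : Prop :=
  ∀ x y : Circle, (x, y) ∈ V → (y, x) ∈ V

/-- `s` is a symmetric motion planning rule on `V ⊆ S¹ × S¹`: a continuous map from `V`
to the path space `C(I, S¹) = PS¹` (carrying the compact-open topology), sending each
`(x, y) ∈ V` to a path from `x` to `y`, such that `s (y, x)` is the time-reversal of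
`s (x, y)`. -/
def IsSymmetricMPR (V : Set (Circle × Circle)) (s : V → C(unitInterval, Circle)) : Prop :=
  Continuous s ∧
  (∀ p : V, s p 0 = p.1.1 ∧ s p 1 = p.1.2) ∧
  (∀ (x y : Circle) (hxy : (x, y) ∈ V) (hyx : (y, x) ∈ V) (t : unitInterval),
    s ⟨(y, x), hyx⟩ t = s ⟨(x, y), hxy⟩ (σ t))

/-- A map `ℝ × ℝ → ℂ` without zeros that is `2 * π`-periodic in the first variable cannot avoid
the negative real axis on the line `θ = 0` while being `π`-antiperiodic on the line `θ = π`: the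
winding number would be zero on the first line and odd on the second. -/
theorem not_antiperiodic_of_mem_slitPlane {H : ℝ × ℝ → ℂ} (hc : Continuous H)
    (h0 : ∀ x, H x ≠ 0) (hper : ∀ a θ, H (a + 2 * Real.pi, θ) = H (a, θ))
    (hslit : ∀ a, H (a, 0) ∈ Complex.slitPlane) :
    ¬ ∀ a, H (a + Real.pi, Real.pi) = -H (a, Real.pi) := by
  intro hanti
  obtain ⟨L, ⟨-, hL⟩, -⟩ := Complex.isCoveringMapOn_exp.existsUnique_continuousMap_lifts
    ⟨H, hc⟩ (a₀ := 0) (Complex.exp_log (h0 0)) h0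
  replace hL : ∀ x, Complex.exp (L x) = H x := congrFun hL
  have hLc : Continuous L := L.continuous
  have const {A : Type} [TopologicalSpace A] [PreconnectedSpace A] {F : A → ℂ}
      (hF : Continuous F) (c : ℂ) (hexp : ∀ a, Complex.exp (F a) = c) (a b : A) : F a = F b :=
    Complex.isCoveringMap_exp.const_of_comp hF (fun a a' ↦ Subtype.ext (by simp [hexp])) a b
  have hlog := const (F := fun a : ℝ ↦ L (a, 0) - Complex.log (H (a, 0)))
    (by
      have h1 : Continuous fun a : ℝ ↦ Complex.log (H (a, 0)) :=
        Continuous.clog (by fun_prop) hslit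
      fun_prop) 1
    (fun a ↦ by rw [Complex.exp_sub, hL, Complex.exp_log (h0 _), div_self (h0 _)])
  have hshift := const (F := fun x : ℝ × ℝ ↦ L (x.1 + 2 * Real.pi, x.2) - L x) (by fun_prop) 1
    (fun x ↦ by rw [Complex.exp_sub, hL, hL, hper, div_self (h0 _)])
  have hhalf := const (F := fun a : ℝ ↦ L (a + Real.pi, Real.pi) - L (a, Real.pi)) (by fun_prop) (-1)
    (fun a ↦ by rw [Complex.exp_sub, hL, hL, hanti, neg_div, div_self (h0 _)])
  have e1 := hlog (2 * Real.pi) 0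
  have e2 := hshift (0, 0) (0, Real.pi)
  have e3 := hhalf Real.pi 0
  have hp := hper 0 0
  have e4 : Complex.exp (L (Real.pi, Real.pi) - L (0, Real.pi)) = -1 := by
    have := hanti 0
    rw [zero_add] at this
    rw [Complex.exp_sub, hL, hL, this, neg_div, div_self (h0 _)]
  simp only [zero_add] at e1 e2 e3 hp
  rw [hp] at e1
  rw [show Real.pi + Real.pi = 2 * Real.pi by ring] at e3
  have e5 : L (Real.pi, Real.pi) - L (0, Real.pi) = 0 := by linear_combination (-e2 + e1 - e3) / 2
  rw [e5, Complex.exp_zero] at e4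
  norm_num at e4

/-- Multiplying the sign of a function that is continuous and nonvanishing on an open set `U` by a
continuous function vanishing off `U` yields a continuous function. -/
theorem continuous_mul_sign {X : Type*} [TopologicalSpace X] {U : Set X} (hU : IsOpen U)
    {ψ g : X → ℝ} (hψ : Continuous ψ) (hψU : ∀ x ∉ U, ψ x = 0) (hg : ContinuousOn g U)
    (hg0 : ∀ x ∈ U, g x ≠ 0) : Continuous fun x ↦ ψ x * (SignType.sign (g x) : ℝ) := by
  rw [continuous_iff_continuousAt]
  intro x
  by_cases hx : x ∈ U
  · have h1 : ContinuousAt (fun y ↦ SignType.sign (g y)) x :=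
      (continuousAt_sign_of_ne_zero (hg0 x hx)).comp (hg.continuousAt (hU.mem_nhds hx))
    exact hψ.continuousAt.mul
      ((continuous_of_discreteTopology (f := fun s : SignType ↦ (s : ℝ))).continuousAt.comp h1)
  · have h1 : Filter.Tendsto ψ (nhds x) (nhds 0) := by
      simpa [hψU x hx] using hψ.continuousAt.tendsto (x := x)
    rw [ContinuousAt, hψU x hx, zero_mul]
    refine squeeze_zero_norm (fun y ↦ ?_) (by simpa using h1.abs)
    rw [norm_mul, Real.norm_eq_abs]
    refine mul_le_of_le_one_right (abs_nonneg _) ?_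
    cases SignType.sign (g y) <;> simp

/-- `d` is a continuous odd choice of oriented angle from `x` to `y`, for `(x, y) ∈ V`. -/
structure IsOddAngle (V : Set (Circle × Circle)) (d : Circle × Circle → ℝ) : Prop where
  continuousOn : ContinuousOn d V
  exp_eq : ∀ p ∈ V, Circle.exp (d p) = p.2 / p.1
  swap : ∀ p ∈ V, d p.swap = -d p

/-- The total angle swept out by the paths of a symmetric motion planning rule is an odd angle. -/
theorem IsSymmetricMPR.exists_isOddAngle {V : Set (Circle × Circle)}
    (hV : IsSymmetricSet V) {s : V → C(unitInterval, Circle)} (hs : IsSymmetricMPR V s) :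
    ∃ d, IsOddAngle V d := by
  classical
  obtain ⟨hsc, hends, hsymm⟩ := hs
  let F : C(unitInterval × V, Circle) := ⟨fun x ↦ s x.2 x.1 / x.2.1.1, by
    have h1 : Continuous fun x : unitInterval × V ↦ s x.2 x.1 := by fun_prop
    fun_prop⟩
  have hF0 : ∀ p : V, F (0, p) = Circle.exp ((0 : C(V, ℝ)) p) := fun p ↦ by
    simp [F, (hends p).1]
  let D := Circle.isCoveringMap_exp.liftHomotopy F 0 hF0
  have hD : ∀ t p, Circle.exp (D (t, p)) = s p t / p.1.1 := fun t p ↦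
    congrFun (Circle.isCoveringMap_exp.liftHomotopy_lifts F 0 hF0) (t, p)
  have hD0 : ∀ p, D (0, p) = 0 := Circle.isCoveringMap_exp.liftHomotopy_zero F 0 hF0
  refine ⟨fun p ↦ if hp : p ∈ V then D (1, ⟨p, hp⟩) else 0, ?_, ?_, ?_⟩
  · rw [continuousOn_iff_continuous_domRestrict]
    have : Continuous fun p : V ↦ D (1, p) := by fun_prop
    convert! this with p
    simp
  · intro p hp
    simp [hp, hD, (hends ⟨p, hp⟩).2]
  · rintro ⟨x, y⟩ hp
    have hq : (y, x) ∈ V := hV x y hp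
    have key := Circle.isCoveringMap_exp.eq_of_comp_eq
      (g₁ := fun t ↦ D (t, ⟨(y, x), hq⟩))
      (g₂ := fun t ↦ D (σ t, ⟨(x, y), hp⟩) - D (1, ⟨(x, y), hp⟩)) (by fun_prop) (by fun_prop)
      (by
        ext1 t
        simp only [Function.comp_apply, Circle.exp_sub, hD, hsymm x y hp hq,
          (hends ⟨(x, y), hp⟩).2]
        rw [div_div_div_cancel_right])
      0 (by simp [hD0])
    have := congrFun key 1
    simpa [hp, hq, hD0] using this

section OddAngle

variable {V : Set (Circle × Circle)} {d : Circle × Circle → ℝ}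

theorem IsOddAngle.diag (hd : IsOddAngle V d) {x : Circle} (hx : (x, x) ∈ V) : d (x, x) = 0 := by
  have := hd.swap _ hx
  rw [Prod.swap_prod_mk] at this
  linarith

theorem IsOddAngle.sub_add_pi_ne_zero (hd : IsOddAngle V d) {a θ : ℝ}
    (h : (Circle.exp a, Circle.exp (a + θ)) ∈ V) :
    d (Circle.exp a, Circle.exp (a + θ)) - θ + Real.pi ≠ 0 := by
  intro h0
  have h1 := hd.exp_eq _ h
  rw [show d (Circle.exp a, Circle.exp (a + θ)) = θ - Real.pi by linarith, ← Circle.exp_sub,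
    Circle.exp_eq_exp] at h1
  obtain ⟨m, hm⟩ := h1
  have h2 : Real.pi * (2 * m + 1) = 0 := by linear_combination -hm
  have h3 : (2 * m + 1 : ℝ) = 0 := (mul_eq_zero.1 h2).resolve_left Real.pi_ne_zero
  have h4 : 2 * m + 1 = 0 := by exact_mod_cast h3
  omega

end OddAngle

/-- Disjoint closed symmetric subsets of `S¹ × S¹` are separated by a symmetric function. -/
theorem exists_symmetric_urysohn {V V' : Set (Circle × Circle)} (hcov : V ∪ V' = Set.univ)
    (hVo : IsOpen V) (hV : IsSymmetricSet V) (hVo' : IsOpen V') (hV' : IsSymmetricSet V') :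
    ∃ ψ : Circle × Circle → ℝ, Continuous ψ ∧ (∀ p, ψ p.swap = ψ p) ∧ (∀ p, 0 ≤ ψ p) ∧
      (∀ p, ψ p ≤ 1) ∧ (∀ p ∉ V, ψ p = 0) ∧ ∀ p ∉ V', ψ p = 1 := by
  obtain ⟨f, hf0, hf1, hf⟩ := exists_continuous_zero_one_of_isClosed hVo.isClosed_compl
    hVo'.isClosed_compl (by
      rw [Set.disjoint_compl_left_iff_subset, Set.compl_subset_iff_union, Set.union_comm, hcov])
  refine ⟨fun p ↦ (f p + f p.swap) / 2, by fun_prop, fun p ↦ ?_, fun p ↦ ?_, fun p ↦ ?_,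
    fun p hp ↦ ?_, fun p hp ↦ ?_⟩
  · simp [add_comm]
  · linarith [(hf p).1, (hf p.swap).1]
  · linarith [(hf p).2, (hf p.swap).2]
  · have hq : p.swap ∉ V := fun h ↦ hp (hV _ _ h)
    simp [hf0 hp, hf0 hq]
  · have hq : p.swap ∉ V' := fun h ↦ hp (hV' _ _ h)
    simp [hf1 hp, hf1 hq]

/-- `S¹ × S¹` cannot be covered by two symmetric open subsets each of which admits a
symmetric motion planning rule. -/
theorem no_cover_by_two_symmetric_mpr_sets :
    ¬ ∃ V V' : Set (Circle × Circle),
      V ∪ V' = Set.univ ∧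
      IsOpen V ∧ IsSymmetricSet V ∧
        (∃ s : V → C(unitInterval, Circle), IsSymmetricMPR V s) ∧
      IsOpen V' ∧ IsSymmetricSet V' ∧
        (∃ s' : V' → C(unitInterval, Circle), IsSymmetricMPR V' s') := by
  rintro ⟨V, V', hcov, hVo, hV, ⟨s, hs⟩, hVo', hV', ⟨s', hs'⟩⟩
  obtain ⟨d, hd⟩ := hs.exists_isOddAngle hV
  obtain ⟨d', hd'⟩ := hs'.exists_isOddAngle hV'
  obtain ⟨ψ, hψ, hsymm, hnonneg, hle, hψV, hψV'⟩ :=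
    exists_symmetric_urysohn hcov hVo hV hVo' hV'
  let P : ℝ × ℝ → Circle × Circle := fun x ↦ (Circle.exp x.1, Circle.exp (x.1 + x.2))
  have hP : Continuous P := by fun_prop
  let f : ℝ × ℝ → ℝ := fun x ↦ ψ (P x) * (SignType.sign (d (P x) - x.2 + Real.pi) : ℝ)
  let f' : ℝ × ℝ → ℝ := fun x ↦ (1 - ψ (P x)) * (SignType.sign (d' (P x) - x.2 + Real.pi) : ℝ)
  have hne : ∀ x, P x ∈ V → d (P x) - x.2 + Real.pi ≠ 0 := fun x ↦ hd.sub_add_pi_ne_zero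
  have hne' : ∀ x, P x ∈ V' → d' (P x) - x.2 + Real.pi ≠ 0 := fun x ↦ hd'.sub_add_pi_ne_zero
  have hf : Continuous f := by
    refine continuous_mul_sign (hVo.preimage hP) (hψ.comp hP) (fun x hx ↦ hψV _ hx) ?_ hne
    have := hd.continuousOn.comp hP.continuousOn (Set.mapsTo_preimage P V)
    exact (this.sub (by fun_prop)).add (by fun_prop)
  have hf' : Continuous f' := by
    refine continuous_mul_sign (hVo'.preimage hP) (continuous_const.sub (hψ.comp hP))
      (fun x hx ↦ by simp [hψV' _ hx]) ?_ hne'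
    have := hd'.continuousOn.comp hP.continuousOn (Set.mapsTo_preimage P V')
    exact (this.sub (by fun_prop)).add (by fun_prop)
  have hPper : ∀ a θ, P (a + 2 * Real.pi, θ) = P (a, θ) := fun a θ ↦ by
    simp [P]
  have hPswap : ∀ a, P (a + Real.pi, Real.pi) = (P (a, Real.pi)).swap := fun a ↦ by
    simp only [P, Prod.swap_prod_mk, Prod.mk.injEq, true_and]
    rw [add_assoc, ← two_mul, Circle.exp_add_two_pi]
  have hPdiag : ∀ a, P (a, 0) = (Circle.exp a, Circle.exp a) := fun a ↦ by simp [P]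
  have hfdiag : ∀ a, f (a, 0) = ψ (P (a, 0)) := fun a ↦ by
    by_cases h : P (a, 0) ∈ V
    · have : d (P (a, 0)) = 0 := by rw [hPdiag] at h ⊢; exact hd.diag h
      simp [f, this, sign_pos Real.pi_pos]
    · simp [f, hψV _ h]
  have hfdiag' : ∀ a, f' (a, 0) = 1 - ψ (P (a, 0)) := fun a ↦ by
    by_cases h : P (a, 0) ∈ V'
    · have : d' (P (a, 0)) = 0 := by rw [hPdiag] at h ⊢; exact hd'.diag h
      simp [f', this, sign_pos Real.pi_pos]
    · simp [f', hψV' _ h]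
  have hfanti : ∀ a, f (a + Real.pi, Real.pi) = -f (a, Real.pi) := fun a ↦ by
    by_cases h : P (a, Real.pi) ∈ V
    · simp [f, hPswap, hsymm, hd.swap _ h, Left.sign_neg]
    · simp [f, hPswap, hsymm, hψV _ h]
  have hfanti' : ∀ a, f' (a + Real.pi, Real.pi) = -f' (a, Real.pi) := fun a ↦ by
    by_cases h : P (a, Real.pi) ∈ V'
    · simp [f', hPswap, hsymm, hd'.swap _ h, Left.sign_neg]
    · simp [f', hPswap, hsymm, hψV' _ h]
  have hsign : ∀ r : ℝ, r ≠ 0 → (SignType.sign r : ℝ) ≠ 0 := fun r hr ↦ by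
    rcases hr.lt_or_gt with h | h <;> simp [h]
  refine not_antiperiodic_of_mem_slitPlane (H := fun x ↦ f x + f' x * Complex.I) (by fun_prop)
    (fun x hx ↦ ?_) (fun a θ ↦ by simp [f, f', hPper]) (fun a ↦ ?_)
    (fun a ↦ by simp only [hfanti, hfanti']; push_cast; ring)
  · have hre : f x = 0 := by simpa using congrArg Complex.re hx
    have him : f' x = 0 := by simpa using congrArg Complex.im hx
    by_cases h : P x ∈ V
    · have hψ0 := (mul_eq_zero.1 hre).resolve_right (hsign _ (hne x h))
      have h' : P x ∈ V' := by
        by_contra h'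
        linarith [hψV' _ h']
      have := (mul_eq_zero.1 him).resolve_right (hsign _ (hne' x h'))
      linarith
    · have h' : P x ∈ V' := ((Set.mem_union ..).1 (hcov ▸ Set.mem_univ (P x))).resolve_left h
      have := (mul_eq_zero.1 him).resolve_right (hsign _ (hne' x h'))
      linarith [hψV _ h]
  · rw [Complex.mem_slitPlane_iff]
    simp only [hfdiag, hfdiag']
    by_cases h : ψ (P (a, 0)) = 0
    · right; simp [h]
    · left; simpa using (hnonneg _).lt_of_ne' h
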